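/- Let X and Y be real Banach spaces, let 2 ≤ p < ∞, and let Z be a real Banach space that is an L_p-space. Suppose T : X → Y is a Lipschitz map for which there exists a bounded linear operator L : X → Z with ‖T(x) − T(q)‖ ≤ ‖L(x) − L(q)‖ for all x, q ∈ X, and suppose the adjoint L* : Z* → X* is almost p-summing. Then T is Lipschitz 1-dominated; that is, there exist a real Banach space W and an absolutely 1-summing bounded linear operator L' : X → W such that ‖T(x) − T(q)‖ ≤ ‖L'(x) − L'(q)‖ for all x, q ∈ X. -/

import Mathlib

open scoped BigOperators NNReal

/-- The weak `ℓ_p` norm of a finite family in a normed space. -/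
noncomputable def weakNorm (p : ℝ) {E : Type*} [NormedAddCommGroup E] [NormedSpace ℝ E]
    {n : ℕ} (x : Fin n → E) : ℝ :=
  ⨆ φ : {φ : E →L[ℝ] ℝ // ‖φ‖ ≤ 1}, (∑ i, |φ.1 (x i)| ^ p) ^ (1 / p)

/-- The Rademacher average `(2^{-n} ∑_{ε ∈ {−1,1}^n} ‖∑ εᵢ yᵢ‖²)^{1/2}`. -/
noncomputable def radAvg {F : Type*} [NormedAddCommGroup F] [NormedSpace ℝ F]
    {n : ℕ} (y : Fin n → F) : ℝ :=
  Real.sqrt ((2 ^ n : ℝ)⁻¹ *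
    ∑ ε : Fin n → Bool, ‖∑ i, (if ε i then (1 : ℝ) else -1) • y i‖ ^ 2)

/-- A map `u : E → F` is almost `p`-summing. -/
def AlmostSumming (p : ℝ) {E F : Type*} [NormedAddCommGroup E] [NormedSpace ℝ E]
    [NormedAddCommGroup F] [NormedSpace ℝ F] (u : E → F) : Prop :=
  ∃ C : ℝ, 0 ≤ C ∧ ∀ (n : ℕ) (x : Fin n → E),
    radAvg (fun i => u (x i)) ≤ C * weakNorm p x

/-- A map `u : E → F` is absolutely `1`-summing. -/
def AbsolutelyOneSumming {E F : Type*} [NormedAddCommGroup E] [NormedSpace ℝ E]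
    [NormedAddCommGroup F] (u : E → F) : Prop :=
  ∃ C : ℝ, 0 ≤ C ∧ ∀ (n : ℕ) (x : Fin n → E),
    ∑ i, ‖u (x i)‖ ≤ C * weakNorm 1 x

/-- The `ℓ_p` norm on `ℝ^m`. -/
noncomputable def lpNorm (p : ℝ) {m : ℕ} (y : Fin m → ℝ) : ℝ :=
  (∑ k, |y k| ^ p) ^ (1 / p)

/-- `Z` is an `L_{p,λ}`-space. -/
def IsLpSpaceWith (p lam : ℝ) (Z : Type*) [NormedAddCommGroup Z] [NormedSpace ℝ Z] : Prop :=
  ∀ E : Submodule ℝ Z, FiniteDimensional ℝ E →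
    ∃ Z₀ : Submodule ℝ Z, E ≤ Z₀ ∧ FiniteDimensional ℝ Z₀ ∧
      ∃ v : Z₀ ≃ₗ[ℝ] (Fin (Module.finrank ℝ Z₀) → ℝ), ∃ a b : ℝ,
        (∀ z : Z₀, lpNorm p (v z) ≤ a * ‖z‖) ∧
        (∀ w : Fin (Module.finrank ℝ Z₀) → ℝ, ‖v.symm w‖ ≤ b * lpNorm p w) ∧
        a * b ≤ lam

section Rademacher

/-- The real sign attached to a Boolean. -/
noncomputable def boolSign (b : Bool) : ℝ := if b then 1 else -1

lemma sum_fin_succ_pi {M Ω : Type*} [AddCommMonoid M] [Fintype Ω] (n : ℕ)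
    (f : (Fin (n + 1) → Ω) → M) :
    ∑ ω, f ω = ∑ a : Ω, ∑ ω : Fin n → Ω, f (Fin.cons a ω) := by
  rw [← (Fin.consEquiv (fun _ : Fin (n + 1) => Ω)).sum_comp, Fintype.sum_prod_type]
  rfl

lemma sum_boolSign_sq (n : ℕ) (a : Fin n → ℝ) :
    ∑ ε : Fin n → Bool, (∑ i, boolSign (ε i) * a i) ^ 2 = 2 ^ n * ∑ i, a i ^ 2 := by
  induction n with
  | zero => simp
  | succ n ih =>
    rw [sum_fin_succ_pi, Fintype.sum_bool, ← Finset.sum_add_distrib]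
    simp only [Fin.sum_univ_succ, Fin.cons_zero, Fin.cons_succ]
    have h : ∀ ε : Fin n → Bool,
        (boolSign true * a 0 + ∑ i : Fin n, boolSign (ε i) * a i.succ) ^ 2 +
        (boolSign false * a 0 + ∑ i : Fin n, boolSign (ε i) * a i.succ) ^ 2 =
        2 * a 0 ^ 2 + 2 * (∑ i : Fin n, boolSign (ε i) * a i.succ) ^ 2 := by
      intro ε; simp [boolSign]; ring
    simp only [h, Finset.sum_add_distrib, ← Finset.mul_sum, ih (fun i => a i.succ)]
    simp
    ring

lemma sum_boolSign_pow_four_le (n : ℕ) (a : Fin n → ℝ) :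
    ∑ ε : Fin n → Bool, (∑ i, boolSign (ε i) * a i) ^ 4 ≤ 3 * 2 ^ n * (∑ i, a i ^ 2) ^ 2 := by
  induction n with
  | zero => simp
  | succ n ih =>
    rw [sum_fin_succ_pi, Fintype.sum_bool, ← Finset.sum_add_distrib]
    simp only [Fin.sum_univ_succ, Fin.cons_zero, Fin.cons_succ]
    have h : ∀ ε : Fin n → Bool,
        (boolSign true * a 0 + ∑ i : Fin n, boolSign (ε i) * a i.succ) ^ 4 +
        (boolSign false * a 0 + ∑ i : Fin n, boolSign (ε i) * a i.succ) ^ 4 =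
        2 * a 0 ^ 4 + 12 * a 0 ^ 2 * (∑ i : Fin n, boolSign (ε i) * a i.succ) ^ 2
          + 2 * (∑ i : Fin n, boolSign (ε i) * a i.succ) ^ 4 := by
      intro ε; simp [boolSign]; ring
    simp only [h, Finset.sum_add_distrib, ← Finset.mul_sum,
      sum_boolSign_sq n (fun i => a i.succ)]
    have := ih (fun i => a i.succ)
    have h4 : 0 ≤ (2 : ℝ) ^ n * a 0 ^ 4 := by positivity
    simp only [Finset.sum_const, Finset.card_univ, Fintype.card_pi_const, Fintype.card_bool,
      nsmul_eq_mul]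
    push_cast
    rw [pow_succ 2 n]
    nlinarith

/-- Khinchine's inequality in `L¹`. -/
lemma khinchine_one (n : ℕ) (a : Fin n → ℝ) :
    5 / 9 * 2 ^ n * Real.sqrt (∑ i, a i ^ 2) ≤
      ∑ ε : Fin n → Bool, |∑ i, boolSign (ε i) * a i| := by
  set A := Real.sqrt (∑ i, a i ^ 2) with hA
  have hA2 : A ^ 2 = ∑ i, a i ^ 2 := Real.sq_sqrt (Finset.sum_nonneg fun i _ => sq_nonneg _)
  rcases (Real.sqrt_nonneg (∑ i, a i ^ 2)).eq_or_lt with h0 | h0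
  · rw [← hA] at h0
    rw [← h0, mul_zero]
    exact Finset.sum_nonneg fun _ _ => abs_nonneg _
  rw [← hA] at h0
  have key : ∀ t : ℝ, A ^ 2 * t ^ 2 - 4 / 27 * t ^ 4 ≤ A ^ 3 * |t| := by
    intro t
    have ht : t ^ 2 = |t| ^ 2 := (sq_abs t).symm
    have ht4 : t ^ 4 = |t| ^ 4 := by rw [show 4 = 2 * 2 from rfl, pow_mul, ht, ← pow_mul]
    rw [ht, ht4]
    have hs : 0 ≤ |t| := abs_nonneg t
    generalize |t| = s at hs
    have h1 : A ^ 3 * s - (A ^ 2 * s ^ 2 - 4 / 27 * s ^ 4)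
        = 4 / 27 * s * (s - 3 / 2 * A) ^ 2 * (s + 3 * A) := by ring
    have h2 : 0 ≤ 4 / 27 * s * (s - 3 / 2 * A) ^ 2 * (s + 3 * A) := by positivity
    linarith
  have hsum := Finset.sum_le_sum (s := Finset.univ) fun (ε : Fin n → Bool) _ =>
    key (∑ i, boolSign (ε i) * a i)
  rw [Finset.sum_sub_distrib, ← Finset.mul_sum, ← Finset.mul_sum, ← Finset.mul_sum,
    sum_boolSign_sq, ← hA2] at hsum
  have h4 := sum_boolSign_pow_four_le n a
  rw [← hA2] at h4
  refine le_of_mul_le_mul_left ?_ (pow_pos h0 3)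
  nlinarith

end Rademacher

section Symmetrization

variable {Ω F : Type*} [NormedAddCommGroup F] [NormedSpace ℝ F]

lemma sum_norm_sq_add_ge (σ : Ω ≃ Ω) (S : Ω → ℝ) (hS : ∀ ω, S (σ ω) = -S ω) (A : Finset Ω) (hA : ∀ ω, σ ω ∈ A ↔ ω ∈ A) (x y : F) :
    A.card * ‖x‖ ^ 2 ≤ ∑ ω ∈ A, ‖x + S ω • y‖ ^ 2 ∧
    ∑ ω ∈ A, ‖S ω • y‖ ^ 2 ≤ ∑ ω ∈ A, ‖x + S ω • y‖ ^ 2 := by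
  have hflip : ∑ ω ∈ A, ‖x - S ω • y‖ ^ 2 = ∑ ω ∈ A, ‖x + S ω • y‖ ^ 2 := by
    refine Finset.sum_equiv σ (fun ω => (hA ω).symm) fun ω _ => ?_
    rw [hS, neg_smul, sub_eq_add_neg]
  have hav : ∀ u v : F, 2 * ‖u‖ ^ 2 ≤ ‖u + v‖ ^ 2 + ‖u - v‖ ^ 2 := by
    intro u v
    have h : 2 * ‖u‖ ≤ ‖u + v‖ + ‖u - v‖ := by
      have := norm_add_le (u + v) (u - v)
      rw [show u + v + (u - v) = (2 : ℝ) • u by rw [two_smul]; abel, norm_smul] at this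
      simpa using this
    nlinarith [sq_nonneg (‖u + v‖ - ‖u - v‖), norm_nonneg u]
  constructor
  · have := Finset.sum_le_sum (s := A) fun ω _ => hav x (S ω • y)
    rw [Finset.sum_add_distrib, hflip] at this
    simp only [Finset.sum_const, nsmul_eq_mul] at this
    linarith
  · have := Finset.sum_le_sum (s := A) fun ω _ => hav (S ω • y) x
    rw [Finset.sum_add_distrib, ← Finset.mul_sum] at this
    simp only [add_comm _ x, norm_sub_rev _ x] at this
    rw [hflip] at this
    linarith

/-- A lower bound for the second moment of a sum of independent symmetric multiples of vectors:
`A` is the event that the scalar coefficient is at least `t` in absolute value. -/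
lemma sum_pi_norm_sq_ge [Fintype Ω] (σ : Ω ≃ Ω) (S : Ω → ℝ) (hS : ∀ ω, S (σ ω) = -S ω)
    [DecidableEq Ω] (A : Finset Ω) (hA : ∀ ω, σ ω ∈ A ↔ ω ∈ A) {t δ : ℝ} (ht : 0 ≤ t) (hδ : 0 ≤ δ)
    (hAt : ∀ ω ∈ A, t ≤ |S ω|) (n : ℕ) (y : Fin n → F) (hy : ∀ i, δ ≤ ‖y i‖) (x : F) :
    (Fintype.card Ω : ℝ) ^ n * ‖x‖ ^ 2 ≤ ∑ ω : Fin n → Ω, ‖x + ∑ i, S (ω i) • y i‖ ^ 2 ∧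
    (t * δ) ^ 2 * ((Fintype.card Ω : ℝ) ^ n - (Aᶜ.card : ℝ) ^ n) ≤
      ∑ ω : Fin n → Ω, ‖x + ∑ i, S (ω i) • y i‖ ^ 2 := by
  induction n generalizing x with
  | zero => simp
  | succ n ih =>
    rw [sum_fin_succ_pi]
    simp only [Fin.sum_univ_succ, Fin.cons_zero, Fin.cons_succ, ← add_assoc]
    have ih' := ih (fun i => y i.succ) (fun i => hy i.succ)
    have hc : (0 : ℝ) ≤ (Fintype.card Ω : ℝ) ^ n := by positivity
    constructor
    · refine le_trans ?_ (Finset.sum_le_sum fun a _ => (ih' (x + S a • y 0)).1)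
      rw [← Finset.mul_sum, pow_succ, mul_assoc]
      exact mul_le_mul_of_nonneg_left
        (sum_norm_sq_add_ge σ S hS Finset.univ (by simp) x (y 0)).1 hc
    · rw [← Finset.sum_add_sum_compl A]
      have h1 : (A.card : ℝ) * ((Fintype.card Ω : ℝ) ^ n * (t * δ) ^ 2) ≤
          ∑ a ∈ A, ∑ ω : Fin n → Ω, ‖x + S a • y 0 + ∑ i, S (ω i) • y i.succ‖ ^ 2 := by
        refine le_trans ?_ (Finset.sum_le_sum fun a _ => (ih' (x + S a • y 0)).1)
        rw [← Finset.mul_sum]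
        have := (sum_norm_sq_add_ge σ S hS A hA x (y 0)).2
        have h2 : (A.card : ℝ) * (t * δ) ^ 2 ≤ ∑ ω ∈ A, ‖S ω • y 0‖ ^ 2 := by
          rw [← nsmul_eq_mul]
          refine Finset.card_nsmul_le_sum _ _ _ fun ω hω => ?_
          rw [norm_smul, Real.norm_eq_abs]
          exact pow_le_pow_left₀ (by positivity)
            (mul_le_mul (hAt ω hω) (hy 0) hδ (abs_nonneg _)) 2
        calc _ = (Fintype.card Ω : ℝ) ^ n * ((A.card : ℝ) * (t * δ) ^ 2) := by ring
          _ ≤ _ := mul_le_mul_of_nonneg_left (h2.trans this) hc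
      have h2 : (Aᶜ.card : ℝ) *
          ((t * δ) ^ 2 * ((Fintype.card Ω : ℝ) ^ n - (Aᶜ.card : ℝ) ^ n)) ≤
          ∑ a ∈ Aᶜ, ∑ ω : Fin n → Ω, ‖x + S a • y 0 + ∑ i, S (ω i) • y i.succ‖ ^ 2 := by
        rw [← nsmul_eq_mul]
        exact Finset.card_nsmul_le_sum _ _ _ fun a _ => (ih' (x + S a • y 0)).2
      have h3 : (A.card : ℝ) + Aᶜ.card = Fintype.card Ω := by
        exact_mod_cast Finset.card_add_card_compl A
      calc _ = (A.card : ℝ) * ((Fintype.card Ω : ℝ) ^ n * (t * δ) ^ 2) + (Aᶜ.card : ℝ) *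
          ((t * δ) ^ 2 * ((Fintype.card Ω : ℝ) ^ n - (Aᶜ.card : ℝ) ^ n)) := by
            rw [pow_succ, pow_succ]
            linear_combination (-(t * δ) ^ 2 * (Fintype.card Ω : ℝ) ^ n) * h3
        _ ≤ _ := add_le_add h1 h2

/-- If `2 ^ m` vectors have norm at least `δ`, the sum of `m`-fold Rademacher sums of them
has second moment at least `m² δ² / 2`. -/
lemma sum_rademacher_blocks_ge {m : ℕ} (hm : 1 ≤ m) {δ : ℝ} (hδ : 0 ≤ δ) (y : Fin (2 ^ m) → F)
    (hy : ∀ i, δ ≤ ‖y i‖) :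
    (m * δ) ^ 2 * (2 ^ m) ^ (2 ^ m) ≤
      2 * ∑ ω : Fin (2 ^ m) → Fin m → Bool, ‖∑ i, (∑ k, boolSign (ω i k)) • y i‖ ^ 2 := by
  have hne : (fun _ : Fin m => true) ≠ fun _ => false := fun h => by
    simpa using congrFun h ⟨0, hm⟩
  let A : Finset (Fin m → Bool) := {fun _ => true, fun _ => false}
  have h := (sum_pi_norm_sq_ge (F := F) (Ω := Fin m → Bool)
    (Equiv.arrowCongr (Equiv.refl _) Equiv.boolNot) (fun ω => ∑ k, boolSign (ω k))
    (fun ω => by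
      rw [← Finset.sum_neg_distrib]
      refine Finset.sum_congr rfl fun k _ => ?_
      simp only [Equiv.arrowCongr_apply, Function.comp, Equiv.refl_symm, Equiv.refl_apply]
      cases ω k <;> simp [boolSign])
    A
    (fun ω => by
      have h1 : ∀ b : Bool, (Equiv.arrowCongr (Equiv.refl (Fin m)) Equiv.boolNot ω = fun _ => b) ↔
          ω = fun _ => !b := by
        intro b
        simp only [funext_iff, Equiv.arrowCongr_apply, Function.comp, Equiv.refl_symm,
          Equiv.refl_apply, Equiv.boolNot_apply]
        refine forall_congr' fun k => ?_
        cases ω k <;> cases b <;> simp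
      simp only [A, Finset.mem_insert, Finset.mem_singleton, h1, Bool.not_true, Bool.not_false]
      exact or_comm)
    (t := m) (Nat.cast_nonneg m) hδ
    (fun ω hω => by
      simp only [A, Finset.mem_insert, Finset.mem_singleton] at hω
      rcases hω with rfl | rfl <;> simp [boolSign])
    (2 ^ m) y hy 0).2
  have hAc : (Aᶜ.card : ℝ) = 2 ^ m - 2 := by
    have h3 : (A.card : ℝ) + Aᶜ.card = Fintype.card (Fin m → Bool) := by
      exact_mod_cast Finset.card_add_card_compl A
    rw [Finset.card_pair hne] at h3
    simp at h3
    linarith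
  rw [hAc] at h
  simp only [zero_add, Fintype.card_pi_const, Fintype.card_bool, Nat.cast_pow, Nat.cast_ofNat] at h
  have hb : 2 * ((2 : ℝ) ^ m - 2) ^ (2 ^ m) ≤ (2 ^ m) ^ (2 ^ m) := by
    have h2 : (2 : ℝ) ≤ 2 ^ m := by simpa using pow_le_pow_right₀ (one_le_two (α := ℝ)) hm
    have hpos : (0 : ℝ) < 2 ^ m := by positivity
    have hq := one_add_mul_le_pow (a := 2 / (2 : ℝ) ^ m)
      (by have : (0 : ℝ) ≤ 2 / 2 ^ m := by positivity
          linarith) (2 ^ m)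
    have hq2 : (2 : ℝ) ≤ (1 + 2 / (2 : ℝ) ^ m) ^ (2 ^ m) := by
      refine le_trans ?_ hq
      push_cast
      rw [mul_div_cancel₀ _ hpos.ne']
      norm_num
    calc 2 * ((2 : ℝ) ^ m - 2) ^ (2 ^ m)
        ≤ (1 + 2 / (2 : ℝ) ^ m) ^ (2 ^ m) * ((2 : ℝ) ^ m - 2) ^ (2 ^ m) :=
          mul_le_mul_of_nonneg_right hq2 (pow_nonneg (by linarith) _)
      _ = ((1 + 2 / (2 : ℝ) ^ m) * ((2 : ℝ) ^ m - 2)) ^ (2 ^ m) := (mul_pow _ _ _).symm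
      _ ≤ _ := by
          have : (1 + 2 / (2 : ℝ) ^ m) * ((2 : ℝ) ^ m - 2) = 2 ^ m - 4 / 2 ^ m := by
            field_simp; ring
          have h4 : (0 : ℝ) ≤ 4 / 2 ^ m := by positivity
          refine pow_le_pow_left₀ ?_ (by linarith) _
          exact mul_nonneg (by positivity) (by linarith)
  nlinarith [sq_nonneg ((m : ℝ) * δ)]

end Symmetrization

section Hilbert

variable {X H : Type*} [NormedAddCommGroup X] [NormedSpace ℝ X]
  [NormedAddCommGroup H] [InnerProductSpace ℝ H]

/-- The Rademacher averages of the adjoint of `M`, over families of vectors satisfying Bessel's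
inequality, are bounded by `C`. -/
def AdjointRademacherBounded (M : X →L[ℝ] H) (C : ℝ) : Prop :=
  ∀ (n : ℕ) (u : Fin n → H), (∀ h, ∑ i, (inner ℝ (u i) h) ^ 2 ≤ ‖h‖ ^ 2) →
    ∑ ε : Fin n → Bool, ‖∑ i, boolSign (ε i) • (innerSL ℝ (u i)).comp M‖ ^ 2 ≤ 2 ^ n * C ^ 2

lemma AdjointRademacherBounded.fintype {M : X →L[ℝ] H} {C : ℝ} (hM : AdjointRademacherBounded M C)
    {κ : Type*} [Fintype κ] [DecidableEq κ] (u : κ → H)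
    (hu : ∀ h, ∑ i, (inner ℝ (u i) h) ^ 2 ≤ ‖h‖ ^ 2) :
    ∑ ε : κ → Bool, ‖∑ i, boolSign (ε i) • (innerSL ℝ (u i)).comp M‖ ^ 2 ≤
      2 ^ Fintype.card κ * C ^ 2 := by
  let f := Fintype.equivFin κ
  have h := hM _ (fun i => u (f.symm i)) (fun h => by
    rw [f.symm.sum_comp (fun k => (inner ℝ (u k) h) ^ 2)]
    exact hu h)
  refine le_of_eq_of_le ?_ h
  rw [← (Equiv.arrowCongr f (Equiv.refl Bool)).sum_comp]
  refine Finset.sum_congr rfl fun ε _ => ?_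
  rw [← f.symm.sum_comp (fun k => boolSign (ε k) • (innerSL ℝ (u k)).comp M)]
  rfl

lemma sum_abs_apply_le_norm_mul_weakNorm {n : ℕ} (x : Fin n → X) (φ : X →L[ℝ] ℝ) :
    ∑ j, |φ (x j)| ≤ ‖φ‖ * weakNorm 1 x := by
  have hbdd : BddAbove (Set.range fun φ : {φ : X →L[ℝ] ℝ // ‖φ‖ ≤ 1} =>
      (∑ i, |φ.1 (x i)| ^ (1 : ℝ)) ^ (1 / (1 : ℝ))) := by
    refine ⟨∑ i, ‖x i‖, ?_⟩
    rintro _ ⟨φ, rfl⟩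
    simp only [Real.rpow_one, div_one]
    refine Finset.sum_le_sum fun i _ => ?_
    simpa using φ.1.le_of_opNorm_le φ.2 (x i)
  rcases (norm_nonneg φ).eq_or_lt with h0 | h0
  · have : φ = 0 := norm_eq_zero.1 h0.symm
    simp [this]
  have h := le_ciSup hbdd ⟨‖φ‖⁻¹ • φ, by
    rw [norm_smul, norm_inv, norm_norm, inv_mul_cancel₀ h0.ne']⟩
  simp only [Real.rpow_one, div_one, smul_apply, smul_eq_mul, abs_mul,
    abs_inv, abs_norm, ← Finset.mul_sum] at h
  rw [inv_mul_le_iff₀ h0] at h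
  simpa only [weakNorm, Real.rpow_one, div_one] using h

/-- Pietsch-type estimate: an operator into a Hilbert space whose adjoint has bounded Rademacher
averages is absolutely summing. -/
lemma AdjointRademacherBounded.sum_norm_le {M : X →L[ℝ] H} {C : ℝ} (hC : 0 ≤ C)
    (hM : AdjointRademacherBounded M C) {n : ℕ} (x : Fin n → X) :
    ∑ j, ‖M (x j)‖ ≤ 9 / 5 * C * weakNorm 1 x := by
  let V := Submodule.span ℝ (Set.range fun j => M (x j))
  have : FiniteDimensional ℝ V := FiniteDimensional.span_of_finite ℝ (Set.finite_range _)
  let b := stdOrthonormalBasis ℝ V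
  let d := Module.finrank ℝ V
  let u : Fin d → H := fun i => (b i : H)
  have huo : Orthonormal ℝ u := b.orthonormal.comp_linearIsometry V.subtypeₗᵢ
  have hu : ∀ h, ∑ i, (inner ℝ (u i) h) ^ 2 ≤ ‖h‖ ^ 2 := by
    intro h
    simpa using huo.sum_inner_products_le h (s := Finset.univ)
  have hS := hM d u hu
  set S : (Fin d → Bool) → (X →L[ℝ] ℝ) :=
    fun ε => ∑ i, boolSign (ε i) • (innerSL ℝ (u i)).comp M with hSdef
  have hsum : ∑ ε, ‖S ε‖ ≤ 2 ^ d * C := by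
    have h1 := sq_sum_le_card_mul_sum_sq (s := Finset.univ) (f := fun ε => ‖S ε‖)
    simp only [Finset.card_univ, Fintype.card_pi_const, Fintype.card_bool, Nat.cast_pow,
      Nat.cast_ofNat] at h1
    refine le_of_sq_le_sq ?_ (by positivity)
    calc _ ≤ _ := h1
      _ ≤ 2 ^ d * (2 ^ d * C ^ 2) := mul_le_mul_of_nonneg_left hS (by positivity)
      _ = _ := by ring
  have hj : ∀ j, 5 / 9 * 2 ^ d * ‖M (x j)‖ ≤ ∑ ε, |S ε (x j)| := by
    intro j
    have hmem : M (x j) ∈ V := Submodule.subset_span ⟨j, rfl⟩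
    have hn := b.sum_sq_norm_inner_right ⟨M (x j), hmem⟩
    have hk := khinchine_one d (fun i => inner ℝ (u i) (M (x j)))
    have hn' : ∑ i, (inner ℝ (u i) (M (x j))) ^ 2 = ‖M (x j)‖ ^ 2 := by
      simpa using hn
    rw [hn', Real.sqrt_sq (norm_nonneg _)] at hk
    simpa [hSdef, sum_apply] using hk
  have hw : 0 ≤ weakNorm 1 x := Real.iSup_nonneg fun φ => by positivity
  have hfin : 5 / 9 * 2 ^ d * ∑ j, ‖M (x j)‖ ≤ 2 ^ d * C * weakNorm 1 x := by
    rw [Finset.mul_sum]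
    calc _ ≤ ∑ j, ∑ ε, |S ε (x j)| := Finset.sum_le_sum fun j _ => hj j
      _ = ∑ ε, ∑ j, |S ε (x j)| := Finset.sum_comm
      _ ≤ ∑ ε, ‖S ε‖ * weakNorm 1 x :=
        Finset.sum_le_sum fun ε _ => sum_abs_apply_le_norm_mul_weakNorm x (S ε)
      _ = (∑ ε, ‖S ε‖) * weakNorm 1 x := by rw [Finset.sum_mul]
      _ ≤ _ := mul_le_mul_of_nonneg_right hsum hw
  have h2 : (0 : ℝ) < 2 ^ d := by positivity
  refine le_of_mul_le_mul_left ?_ h2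
  nlinarith

/-- Only finitely many members of an orthonormal family have a large image under an adjoint with
bounded Rademacher averages. -/
lemma AdjointRademacherBounded.finite_setOf_le {M : X →L[ℝ] H} {C : ℝ}
    (hM : AdjointRademacherBounded M C) {ι : Type*} {b : ι → H} (hb : Orthonormal ℝ b)
    {δ : ℝ} (hδ : 0 < δ) : {i | δ ≤ ‖(innerSL ℝ (b i)).comp M‖}.Finite := by
  by_contra hinf
  obtain ⟨m, hm⟩ := exists_nat_gt (2 * C ^ 2 / δ ^ 2)
  have hm0 : (0 : ℝ) < m := lt_of_le_of_lt (by positivity) hm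
  have hm1 : 1 ≤ m := by exact_mod_cast hm0
  obtain ⟨t, hts, htc⟩ := Set.Infinite.exists_subset_card_eq hinf (2 ^ m)
  let g : Fin (2 ^ m) → ι := fun k => (t.equivFinOfCardEq htc).symm k
  have hg : Function.Injective g :=
    Subtype.val_injective.comp (t.equivFinOfCardEq htc).symm.injective
  have hgδ : ∀ k, δ ≤ ‖(innerSL ℝ (b (g k))).comp M‖ := fun k =>
    hts ((t.equivFinOfCardEq htc).symm k).2
  have hlow := sum_rademacher_blocks_ge hm1 hδ.le (fun k => (innerSL ℝ (b (g k))).comp M) hgδ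
  let u : Fin (2 ^ m) × Fin m → H := fun q => (Real.sqrt m)⁻¹ • b (g q.1)
  have hsq : ((Real.sqrt m)⁻¹) ^ 2 = (m : ℝ)⁻¹ := by
    rw [inv_pow, Real.sq_sqrt hm0.le]
  have hup := hM.fintype u (fun h => by
    have h1 := (hb.comp g hg).sum_inner_products_le h (s := Finset.univ)
    rw [Fintype.sum_prod_type]
    simp only [u, inner_smul_left, mul_pow, Finset.sum_const, Finset.card_univ, Fintype.card_fin,
      nsmul_eq_mul, RCLike.conj_to_real, hsq]
    simp only [← mul_assoc, mul_inv_cancel₀ hm0.ne', one_mul]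
    simpa using h1)
  have heq : ∑ ε : Fin (2 ^ m) × Fin m → Bool,
      ‖∑ q, boolSign (ε q) • (innerSL ℝ (u q)).comp M‖ ^ 2 =
      (m : ℝ)⁻¹ * ∑ ω : Fin (2 ^ m) → Fin m → Bool,
        ‖∑ i, (∑ k, boolSign (ω i k)) • (innerSL ℝ (b (g i))).comp M‖ ^ 2 := by
    rw [← (Equiv.curry (Fin (2 ^ m)) (Fin m) Bool).symm.sum_comp, Finset.mul_sum]
    refine Finset.sum_congr rfl fun ω _ => ?_
    rw [← hsq, ← abs_of_nonneg (inv_nonneg.2 (Real.sqrt_nonneg (m : ℝ))), ← Real.norm_eq_abs,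
      ← mul_pow, ← norm_smul, Fintype.sum_prod_type, Finset.smul_sum]
    refine congrArg (fun z => ‖z‖ ^ 2) ?_
    refine Finset.sum_congr rfl fun i _ => ?_
    rw [Finset.sum_smul, Finset.smul_sum]
    refine Finset.sum_congr rfl fun k _ => ?_
    ext z
    simp [u, Equiv.curry]
    ring
  rw [heq] at hup
  simp only [Fintype.card_prod, Fintype.card_fin] at hup
  rw [mul_comm (2 ^ m) m, pow_mul, inv_mul_le_iff₀ hm0] at hup
  have hP : (0 : ℝ) < (2 ^ m) ^ (2 ^ m) := by positivity
  have h3 : (m * δ) ^ 2 * (2 ^ m) ^ (2 ^ m) ≤ (2 * m * C ^ 2) * (2 ^ m) ^ (2 ^ m) := by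
    linarith
  have h4 := le_of_mul_le_mul_right h3 hP
  rw [div_lt_iff₀ (by positivity)] at hm
  nlinarith

/-- An operator into a Hilbert space whose adjoint has bounded Rademacher averages has separable
range, hence is isometrically dominated by an operator into `ℓ²`. -/
lemma AdjointRademacherBounded.exists_norm_eq [CompleteSpace H] {M : X →L[ℝ] H} {C : ℝ}
    (hM : AdjointRademacherBounded M C) :
    ∃ M' : X →L[ℝ] lp (fun _ : ℕ => ℝ) 2, ∀ x, ‖M' x‖ = ‖M x‖ := by
  obtain ⟨w, b, -⟩ := exists_hilbertBasis ℝ H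
  let s : Set w := {i | (innerSL ℝ (b i)).comp M ≠ 0}
  have hs : s.Countable := by
    have : s = ⋃ n : ℕ, {i | 1 / ((n : ℝ) + 1) ≤ ‖(innerSL ℝ (b i)).comp M‖} := by
      ext i
      simp only [s, Set.mem_ofPred_eq, Set.mem_iUnion]
      constructor
      · intro hi
        obtain ⟨n, hn⟩ := exists_nat_one_div_lt (norm_pos_iff.2 hi)
        exact ⟨n, hn.le⟩
      · rintro ⟨n, hn⟩ h0
        rw [h0, norm_zero] at hn
        have : (0 : ℝ) < 1 / ((n : ℝ) + 1) := by positivity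
        linarith
    rw [this]
    exact Set.countable_iUnion fun n => (hM.finite_setOf_le b.orthonormal (by positivity)).countable
  have := hs.to_subtype
  obtain ⟨f, hf⟩ := exists_injective_nat s
  let a : X →ₗ[ℝ] (ℕ → ℝ) := (Function.ExtendByZero.linearMap ℝ f).comp
    (LinearMap.pi fun i : s => ((innerSL ℝ (b i)).comp M).toLinearMap)
  have ha : ∀ x, HasSum (fun n => a x n ^ 2) (‖M x‖ ^ 2) := by
    intro x
    have h1 := b.hasSum_inner_mul_inner (M x) (M x)
    rw [real_inner_self_eq_norm_sq] at h1
    have h2 : HasSum (fun i : s => (inner ℝ (b i) (M x)) ^ 2) (‖M x‖ ^ 2) := by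
      have : HasSum (fun i : w => (inner ℝ (b i) (M x)) ^ 2) (‖M x‖ ^ 2) := by
        simpa only [real_inner_comm, ← sq] using h1
      refine (Subtype.val_injective.hasSum_iff ?_).2 this
      intro i hi
      have : (innerSL ℝ (b i)).comp M = 0 := by
        by_contra h
        exact hi ⟨⟨i, h⟩, rfl⟩
      have h3 := DFunLike.congr_fun this x
      simp at h3
      simp [h3]
    rw [← hasSum_extend_zero hf] at h2
    convert h2 using 1
    ext n
    change (Function.extend f (fun i : s => inner ℝ (b i) (M x)) 0 n) ^ 2 = _
    by_cases hn : ∃ i, f i = n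
    · obtain ⟨i, rfl⟩ := hn
      simp only [hf.extend_apply]
    · simp [Function.extend_apply' _ _ _ hn]
  have hmem : ∀ x, Memℓp (a x) 2 := by
    intro x
    refine memℓp_gen ?_
    simpa using (ha x).summable
  let M₀ : X →ₗ[ℝ] lp (fun _ : ℕ => ℝ) 2 :=
    { toFun := fun x => ⟨a x, hmem x⟩
      map_add' := fun x y => Subtype.ext (map_add a x y)
      map_smul' := fun c x => Subtype.ext (map_smul a c x) }
  have hnorm : ∀ x, ‖M₀ x‖ = ‖M x‖ := by
    intro x
    have h := lp.norm_rpow_eq_tsum (p := 2) (by simp) (M₀ x)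
    have h2 : ∑' n, a x n ^ 2 = ‖M x‖ ^ 2 := (ha x).tsum_eq
    have h3 : ‖M₀ x‖ ^ 2 = ‖M x‖ ^ 2 := by
      rw [← h2]
      simpa [M₀] using h
    exact (sq_eq_sq₀ (norm_nonneg _) (norm_nonneg _)).1 h3
  exact ⟨M₀.mkContinuous ‖M‖ fun x => (hnorm x).trans_le (M.le_opNorm x), hnorm⟩

end Hilbert

section Renorming

variable {Z : Type*} [NormedAddCommGroup Z] [NormedSpace ℝ Z]

/-- The requirements on a function of two variables to be, on the subspace `E`, an inner product
dominating the square of the norm. -/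
structure IsInnerOn (Q : Z → Z → ℝ) (E : Submodule ℝ Z) : Prop where
  symm : ∀ x ∈ E, ∀ y ∈ E, Q y x = Q x y
  add_left : ∀ x ∈ E, ∀ y ∈ E, ∀ z ∈ E, Q (x + y) z = Q x z + Q y z
  smul_left : ∀ x ∈ E, ∀ y ∈ E, ∀ r : ℝ, Q (r • x) y = r * Q x y
  norm_sq_le : ∀ x ∈ E, ‖x‖ ^ 2 ≤ Q x x

lemma lpNorm_two {m : ℕ} (y : Fin m → ℝ) : lpNorm 2 y = Real.sqrt (∑ k, y k ^ 2) := by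
  rw [lpNorm, Real.sqrt_eq_rpow]
  norm_num

lemma IsLpSpaceWith.exists_isInnerOn {lam : ℝ} (hlam : 0 ≤ lam) (hZ : IsLpSpaceWith 2 lam Z)
    (E : Submodule ℝ Z) [FiniteDimensional ℝ E] :
    ∃ Q : Z → Z → ℝ, (∀ x y, |Q x y| ≤ lam ^ 2 * (‖x‖ * ‖y‖)) ∧ IsInnerOn Q E := by
  classical
  obtain ⟨Z₀, hE, -, v, a, b, ha, hb, hab⟩ := hZ E inferInstance
  simp only [lpNorm_two] at ha hb
  have hlow : ∀ z : Z₀, ‖z‖ ^ 2 ≤ b ^ 2 * ∑ k, v z k ^ 2 := by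
    intro z
    have h := hb (v z)
    rw [v.symm_apply_apply] at h
    calc ‖z‖ ^ 2 ≤ (b * Real.sqrt (∑ k, v z k ^ 2)) ^ 2 := pow_le_pow_left₀ (norm_nonneg z) h 2
      _ = _ := by
        rw [mul_pow, Real.sq_sqrt (Finset.sum_nonneg fun _ _ => sq_nonneg _)]
  have hup : ∀ z : Z₀, |b| * Real.sqrt (∑ k, v z k ^ 2) ≤ lam * ‖z‖ := by
    intro z
    rcases le_or_gt 0 b with h0 | h0
    · rw [abs_of_nonneg h0]
      calc b * Real.sqrt (∑ k, v z k ^ 2) ≤ b * (a * ‖z‖) := mul_le_mul_of_nonneg_left (ha z) h0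
        _ = (a * b) * ‖z‖ := by ring
        _ ≤ _ := mul_le_mul_of_nonneg_right hab (norm_nonneg z)
    · have h := hb (v z)
      rw [v.symm_apply_apply] at h
      have h1 : b * Real.sqrt (∑ k, v z k ^ 2) ≤ 0 :=
        mul_nonpos_of_nonpos_of_nonneg h0.le (Real.sqrt_nonneg _)
      have h2 : z = 0 := norm_le_zero_iff.1 (h.trans h1)
      simp [h2]
  refine ⟨fun x y => if h : x ∈ Z₀ ∧ y ∈ Z₀ then b ^ 2 * ∑ k, v ⟨x, h.1⟩ k * v ⟨y, h.2⟩ k else 0,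
    fun x y => ?_, ⟨fun x hx y hy => ?_, fun x hx y hy z hz => ?_, fun x hx y hy r => ?_,
      fun x hx => ?_⟩⟩
  · beta_reduce
    split_ifs with h
    · have hcs : |∑ k, v ⟨x, h.1⟩ k * v ⟨y, h.2⟩ k| ≤
          Real.sqrt (∑ k, v ⟨x, h.1⟩ k ^ 2) * Real.sqrt (∑ k, v ⟨y, h.2⟩ k ^ 2) := by
        rw [← Real.sqrt_mul (Finset.sum_nonneg fun _ _ => sq_nonneg _)]
        exact Real.abs_le_sqrt (Finset.sum_mul_sq_le_sq_mul_sq _ _ _)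
      calc |b ^ 2 * ∑ k, v ⟨x, h.1⟩ k * v ⟨y, h.2⟩ k|
          = |b| ^ 2 * |∑ k, v ⟨x, h.1⟩ k * v ⟨y, h.2⟩ k| := by rw [abs_mul, abs_pow]
        _ ≤ |b| ^ 2 * (Real.sqrt (∑ k, v ⟨x, h.1⟩ k ^ 2) * Real.sqrt (∑ k, v ⟨y, h.2⟩ k ^ 2)) :=
          mul_le_mul_of_nonneg_left hcs (by positivity)
        _ = (|b| * Real.sqrt (∑ k, v ⟨x, h.1⟩ k ^ 2)) *
            (|b| * Real.sqrt (∑ k, v ⟨y, h.2⟩ k ^ 2)) := by ring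
        _ ≤ (lam * ‖x‖) * (lam * ‖y‖) :=
          mul_le_mul (hup ⟨x, h.1⟩) (hup ⟨y, h.2⟩) (by positivity) (by positivity)
        _ = _ := by ring
    · rw [abs_zero]
      positivity
  · simp only [hE hx, hE hy, and_self, dite_true]
    simp only [mul_comm]
  · simp only [hE hx, hE hy, hE hz, Z₀.add_mem (hE hx) (hE hy), and_self, dite_true]
    have : v ⟨x + y, Z₀.add_mem (hE hx) (hE hy)⟩ = v ⟨x, hE hx⟩ + v ⟨y, hE hy⟩ := by
      rw [← map_add]; rfl
    simp only [this, Pi.add_apply, add_mul, Finset.sum_add_distrib, mul_add]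
  · simp only [hE hx, hE hy, Z₀.smul_mem r (hE hx), and_self, dite_true]
    have : v ⟨r • x, Z₀.smul_mem r (hE hx)⟩ = r • v ⟨x, hE hx⟩ := by
      rw [← map_smul]; rfl
    simp only [this, Pi.smul_apply, smul_eq_mul, mul_assoc, ← Finset.mul_sum]
    ring
  · simp only [hE hx, and_self, dite_true, ← sq]
    exact hlow ⟨x, hE hx⟩

/-- Passing to the limit over finite-dimensional subspaces. -/
lemma IsLpSpaceWith.exists_isInnerOn_top {lam : ℝ} (hlam : 0 ≤ lam) (hZ : IsLpSpaceWith 2 lam Z) :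
    ∃ Q : Z → Z → ℝ, (∀ x y, |Q x y| ≤ lam ^ 2 * (‖x‖ * ‖y‖)) ∧ IsInnerOn Q ⊤ := by
  classical
  have hex : ∀ s : Finset Z, ∃ Q : Z → Z → ℝ, (∀ x y, |Q x y| ≤ lam ^ 2 * (‖x‖ * ‖y‖)) ∧
      IsInnerOn Q (Submodule.span ℝ (s : Set Z)) := fun s => hZ.exists_isInnerOn hlam _
  choose q hqb hq using hex
  let U : Ultrafilter (Finset Z) := Ultrafilter.of Filter.atTop
  have hlim : ∀ x y, ∃ c, |c| ≤ lam ^ 2 * (‖x‖ * ‖y‖) ∧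
      Filter.Tendsto (fun s => q s x y) U (nhds c) := by
    intro x y
    obtain ⟨c, hc, hle⟩ := (isCompact_Icc (a := -(lam ^ 2 * (‖x‖ * ‖y‖)))
      (b := lam ^ 2 * (‖x‖ * ‖y‖))).ultrafilter_le_nhds (U.map fun s => q s x y) (by
        rw [Filter.le_principal_iff]
        exact Ultrafilter.mem_map.2 (Filter.univ_mem' fun s => abs_le.1 (hqb s x y)))
    exact ⟨c, abs_le.2 hc, hle⟩
  choose Q hQb hQ using hlim
  have hev : ∀ x : Z, ∀ᶠ s : Finset Z in (U : Filter (Finset Z)), x ∈ Submodule.span ℝ (s : Set Z) := by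
    intro x
    refine Ultrafilter.of_le _ ?_
    filter_upwards [Filter.eventually_ge_atTop ({x} : Finset Z)] with s hs
    exact Submodule.subset_span (hs (Finset.mem_singleton_self x))
  refine ⟨Q, hQb, ⟨fun x _ y _ => ?_, fun x _ y _ z _ => ?_, fun x _ y _ r => ?_, fun x _ => ?_⟩⟩
  · refine tendsto_nhds_unique_of_eventuallyEq (hQ y x) (hQ x y) ?_
    filter_upwards [hev x, hev y] with s hx hy
    exact (hq s).symm x hx y hy
  · refine tendsto_nhds_unique_of_eventuallyEq (hQ (x + y) z) ((hQ x z).add (hQ y z)) ?_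
    filter_upwards [hev x, hev y, hev z] with s hx hy hz
    exact (hq s).add_left x hx y hy z hz
  · refine tendsto_nhds_unique_of_eventuallyEq (hQ (r • x) y) ((hQ x y).const_mul r) ?_
    filter_upwards [hev x, hev y] with s hx hy
    exact (hq s).smul_left x hx y hy r
  · refine ge_of_tendsto (hQ x x) ?_
    filter_upwards [hev x] with s hx
    exact (hq s).norm_sq_le x hx

/-- A space carrying no topology yet, to be normed by an inner product. -/
def Renormed (Z : Type*) : Type _ := Z

instance : AddCommGroup (Renormed Z) := inferInstanceAs (AddCommGroup Z)

instance : Module ℝ (Renormed Z) := inferInstanceAs (Module ℝ Z)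

lemma IsInnerOn.exists_continuousLinearEquiv.{u} {Z : Type u} [NormedAddCommGroup Z] [NormedSpace ℝ Z]
    [CompleteSpace Z] {Q : Z → Z → ℝ} {lam : ℝ} (hlam : 0 ≤ lam)
    (hQb : ∀ x y, |Q x y| ≤ lam ^ 2 * (‖x‖ * ‖y‖)) (hQ : IsInnerOn Q ⊤) :
    ∃ (H : Type u) (_ : NormedAddCommGroup H) (_ : InnerProductSpace ℝ H) (_ : CompleteSpace H),
      Nonempty (Z ≃L[ℝ] H) := by
  let core : InnerProductSpace.Core ℝ (Renormed Z) :=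
    { inner := Q
      conj_inner_symm := fun x y => hQ.symm x trivial y trivial
      re_inner_nonneg := fun x => (sq_nonneg _).trans (hQ.norm_sq_le x trivial)
      add_left := fun x y z => hQ.add_left x trivial y trivial z trivial
      smul_left := fun x y r => hQ.smul_left x trivial y trivial r
      definite := fun x hx => by
        have h : norm (E := Z) x ^ 2 ≤ 0 := (hQ.norm_sq_le x trivial).trans_eq hx
        exact norm_eq_zero.1 (pow_eq_zero_iff two_ne_zero |>.1 (le_antisymm h (sq_nonneg _))) }
  let _ : NormedAddCommGroup (Renormed Z) := core.toNormedAddCommGroup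
  let _ : InnerProductSpace ℝ (Renormed Z) := InnerProductSpace.ofCore core.toCore
  let e₀ : Z ≃ₗ[ℝ] Renormed Z := LinearEquiv.refl ℝ Z
  have hn : ∀ z, ‖e₀ z‖ ^ 2 = Q z z := fun z => (real_inner_self_eq_norm_sq (F := Renormed Z) (e₀ z)).symm
  let e : Z ≃L[ℝ] Renormed Z := e₀.toContinuousLinearEquivOfBounds lam 1
    (fun z => by
      refine le_of_sq_le_sq ?_ (by positivity)
      rw [hn, mul_pow, sq ‖z‖]
      exact (le_abs_self _).trans (hQb z z))
    (fun z => by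
      rw [one_mul]
      refine le_of_sq_le_sq ?_ (norm_nonneg z)
      have := hQ.norm_sq_le (e₀.symm z) trivial
      rwa [← hn, e₀.apply_symm_apply] at this)
  exact ⟨Renormed Z, _, _, (completeSpace_congr (e := e.toEquiv) e.isUniformEmbedding).1 ‹_›, ⟨e⟩⟩

end Renorming

section Adjoint

variable {X Z : Type*} [NormedAddCommGroup X] [NormedSpace ℝ X]
  [NormedAddCommGroup Z] [NormedSpace ℝ Z]

lemma sum_norm_sq_eq_radAvg_sq {n : ℕ} (y : Fin n → X) :
    ∑ ε : Fin n → Bool, ‖∑ i, boolSign (ε i) • y i‖ ^ 2 = 2 ^ n * radAvg y ^ 2 := by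
  rw [radAvg, Real.sq_sqrt (by positivity), ← mul_assoc, mul_inv_cancel₀ (by positivity), one_mul]
  rfl

lemma radAvg_nonneg {n : ℕ} (y : Fin n → X) : 0 ≤ radAvg y := Real.sqrt_nonneg _

lemma AlmostSumming.exists_adjointRademacherBounded {H : Type*} [NormedAddCommGroup H]
    [InnerProductSpace ℝ H] [CompleteSpace H] {L : X →L[ℝ] Z}
    (hadj : AlmostSumming 2 (fun ψ : Z →L[ℝ] ℝ => ψ.comp L)) (e : Z →L[ℝ] H) :
    ∃ C, 0 ≤ C ∧ AdjointRademacherBounded (e.comp L) C := by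
  obtain ⟨C, hC, h⟩ := hadj
  refine ⟨C * ‖e‖, by positivity, fun n u hu => ?_⟩
  have h1 := h n (fun i => (innerSL ℝ (u i)).comp e)
  have h2 : weakNorm 2 (fun i => (innerSL ℝ (u i)).comp e) ≤ ‖e‖ := by
    refine Real.iSup_le (fun φ => ?_) (norm_nonneg e)
    let ψ : H →L[ℝ] ℝ := φ.1.comp ((ContinuousLinearMap.compL ℝ Z H ℝ).flip e |>.comp (innerSL ℝ))
    have hψ : ‖ψ‖ ≤ ‖e‖ := by
      refine ψ.opNorm_le_bound (norm_nonneg e) fun w => ?_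
      calc ‖φ.1 ((innerSL ℝ w).comp e)‖ ≤ 1 * ‖(innerSL ℝ w).comp e‖ := φ.1.le_of_opNorm_le φ.2 _
        _ ≤ ‖innerSL ℝ w‖ * ‖e‖ := by
          rw [one_mul]; exact ContinuousLinearMap.opNorm_comp_le _ _
        _ = ‖e‖ * ‖w‖ := by rw [innerSL_apply_norm, mul_comm]
    let g : H := (InnerProductSpace.toDual ℝ H).symm ψ
    have hg : ‖g‖ ≤ ‖e‖ := by rwa [LinearIsometryEquiv.norm_map]
    have hgi : ∀ i, φ.1 ((innerSL ℝ (u i)).comp e) = inner ℝ (u i) g := by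
      intro i
      rw [real_inner_comm]
      exact (InnerProductSpace.toDual_symm_apply (𝕜 := ℝ) (x := u i) (y := ψ)).symm
    have hsum := hu g
    rw [← Real.sqrt_eq_rpow]
    refine Real.sqrt_le_iff.2 ⟨norm_nonneg e, ?_⟩
    calc _ = ∑ i, (inner ℝ (u i) g) ^ 2 := by
          refine Finset.sum_congr rfl fun i _ => ?_
          rw [hgi, Real.rpow_two, sq_abs]
      _ ≤ ‖g‖ ^ 2 := hsum
      _ ≤ _ := pow_le_pow_left₀ (norm_nonneg g) hg 2
  have h3 := (sum_norm_sq_eq_radAvg_sq fun i => ((innerSL ℝ (u i)).comp e).comp L)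
  refine (le_of_eq h3).trans (mul_le_mul_of_nonneg_left ?_ (by positivity))
  exact pow_le_pow_left₀ (radAvg_nonneg _) (h1.trans (mul_le_mul_of_nonneg_left h2 hC)) 2

lemma radAvg_const (n : ℕ) (y : X) : radAvg (fun _ : Fin n => y) = Real.sqrt n * ‖y‖ := by
  have h := sum_norm_sq_eq_radAvg_sq fun _ : Fin n => y
  simp only [← Finset.sum_smul, norm_smul, mul_pow, Real.norm_eq_abs, sq_abs, ← Finset.sum_mul]
    at h
  have h2 := sum_boolSign_sq n (fun _ => 1)
  simp only [mul_one] at h2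
  rw [h2] at h
  simp only [one_pow, Finset.sum_const, Finset.card_univ, Fintype.card_fin, nsmul_eq_mul, mul_one,
    mul_assoc] at h
  have h3 := mul_left_cancel₀ (by positivity) h
  refine (sq_eq_sq₀ (radAvg_nonneg _) (by positivity)).1 ?_
  rw [mul_pow, Real.sq_sqrt (Nat.cast_nonneg n), h3]

lemma weakNorm_const_le {p : ℝ} (hp : 0 < p) (n : ℕ) (y : X) :
    weakNorm p (fun _ : Fin n => y) ≤ (n : ℝ) ^ (1 / p) * ‖y‖ := by
  refine Real.iSup_le (fun φ => ?_) (by positivity)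
  have h : |φ.1 y| ≤ ‖y‖ := by simpa using φ.1.le_of_opNorm_le φ.2 y
  simp only [Finset.sum_const, Finset.card_univ, Fintype.card_fin, nsmul_eq_mul]
  rw [Real.mul_rpow (Nat.cast_nonneg n) (by positivity), ← Real.rpow_mul (abs_nonneg _),
    mul_one_div_cancel hp.ne', Real.rpow_one]
  exact mul_le_mul_of_nonneg_left h (by positivity)

/-- For `p > 2` only the zero operator is almost `p`-summing. -/
lemma AlmostSumming.eq_zero {p : ℝ} (hp : 2 < p) {u : X → Z} (hu : AlmostSumming p u) (x : X) :
    u x = 0 := by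
  obtain ⟨C, hC, h⟩ := hu
  by_contra hne
  have hpos : 0 < ‖u x‖ := norm_pos_iff.2 hne
  have hexp : 0 < 1 / 2 - 1 / p := by
    rw [sub_pos]
    exact one_div_lt_one_div_of_lt two_pos hp
  have htend := (tendsto_rpow_atTop hexp).comp (tendsto_natCast_atTop_atTop (R := ℝ))
  obtain ⟨n, hn, hn1⟩ := ((htend.eventually_gt_atTop (C * ‖x‖ / ‖u x‖)).and
    (Filter.eventually_ge_atTop 1)).exists
  have hn0 : (0 : ℝ) < n := by exact_mod_cast hn1
  have h1 := (h n fun _ => x).trans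
    (mul_le_mul_of_nonneg_left (weakNorm_const_le (by linarith) n x) hC)
  rw [radAvg_const] at h1
  simp only [Function.comp] at hn
  rw [Real.rpow_sub hn0, ← Real.sqrt_eq_rpow, div_lt_div_iff₀ hpos (by positivity)] at hn
  nlinarith

end Adjoint

/-- Let `X`, `Y` be real Banach spaces, `2 ≤ p < ∞`, and `Z` a real Banach `L_p`-space.
If `T : X → Y` is Lipschitz, dominated by a bounded linear operator `L : X → Z`
(`‖T(x) − T(q)‖ ≤ ‖L(x) − L(q)‖`) whose adjoint `L* : Z* → X*` is almost `p`-summing,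
then `T` is Lipschitz `1`-dominated: there are a real Banach space `W` and an absolutely
`1`-summing bounded linear operator `L' : X → W` with `‖T(x) − T(q)‖ ≤ ‖L'(x) − L'(q)‖`. -/
theorem lipschitz_one_dominated {X Y Z : Type*}
    [NormedAddCommGroup X] [NormedSpace ℝ X] [CompleteSpace X]
    [NormedAddCommGroup Y] [NormedSpace ℝ Y] [CompleteSpace Y]
    [NormedAddCommGroup Z] [NormedSpace ℝ Z] [CompleteSpace Z]
    (p : ℝ) (hp : 2 ≤ p) (hZ : ∃ lam : ℝ, 1 < lam ∧ IsLpSpaceWith p lam Z)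
    (T : X → Y) (hT : ∃ K : ℝ≥0, LipschitzWith K T)
    (L : X →L[ℝ] Z)
    (hdom : ∀ x q : X, ‖T x - T q‖ ≤ ‖L x - L q‖)
    (hadj : AlmostSumming p (fun ψ : Z →L[ℝ] ℝ => ψ.comp L)) :
    ∃ (W : Type) (_ : NormedAddCommGroup W) (_ : NormedSpace ℝ W) (_ : CompleteSpace W)
      (L' : X →L[ℝ] W),
      AbsolutelyOneSumming (fun x => L' x) ∧
      ∀ x q : X, ‖T x - T q‖ ≤ ‖L' x - L' q‖ := by
  obtain ⟨lam, hlam, hZ⟩ := hZ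
  rcases hp.eq_or_lt with rfl | hp
  · obtain ⟨Q, hQb, hQ⟩ := hZ.exists_isInnerOn_top (by linarith)
    obtain ⟨H, _, _, _, ⟨e⟩⟩ := hQ.exists_continuousLinearEquiv (by linarith) hQb
    obtain ⟨C, hC, hM⟩ := hadj.exists_adjointRademacherBounded (e : Z →L[ℝ] H)
    obtain ⟨M', hM'⟩ := hM.exists_norm_eq
    set K := ‖(e.symm : H →L[ℝ] Z)‖
    refine ⟨lp (fun _ : ℕ => ℝ) 2, inferInstance, inferInstance, inferInstance, K • M',
      ⟨K * (9 / 5 * C), by positivity, fun n x => ?_⟩, fun x q => (hdom x q).trans ?_⟩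
    · simp only [smul_apply, norm_smul, hM', ← Finset.mul_sum, K, norm_norm]
      rw [mul_assoc]
      exact mul_le_mul_of_nonneg_left (hM.sum_norm_le hC x) (norm_nonneg _)
    · rw [← map_sub, ← map_sub, smul_apply, norm_smul, hM', norm_norm]
      simpa using (e.symm : H →L[ℝ] Z).le_opNorm (e (L (x - q)))
  · have hL : L = 0 := by
      ext x
      refine SeparatingDual.eq_zero_of_forall_dual_eq_zero (R := ℝ) fun ψ => ?_
      exact DFunLike.congr_fun (hadj.eq_zero hp ψ) x
    refine ⟨ℝ, inferInstance, inferInstance, inferInstance, 0,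
      ⟨0, le_rfl, fun n x => by simp⟩, fun x q => ?_⟩
    simpa [hL] using hdom x q
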